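/- arXiv:2210.05389 — 4 statements merged into one kernel-verified Lean document; each statement's English description precedes it below -/
import Mathlib

section
/- Bound on the convolution of exponential and algebraic decays: For every integer d ≥ 1 and real α > d there exists a constant c > 0 depending only on α and d such that for all ξ > α − 1 and all R₁, R₂ ∈ ℤ^d, Σ_{R ∈ ℤ^d} min{e^{ξ − |R − R₂|}, 1} / (|R₁ − R| + 1)^α ≤ c · min{(4(ξ + 1)/(|R₁ − R₂| + 1))^α, 1}. -/
noncomputable section

/-- Euclidean norm of a lattice vector in `ℤ^d`. -/
def latNorm {d : ℕ} (r : Fin d → ℤ) : ℝ := Real.sqrt (∑ i, ((r i : ℝ)) ^ 2)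

/-- Euclidean distance between two lattice sites. -/
def latDist {d : ℕ} (r r' : Fin d → ℤ) : ℝ := latNorm (r - r')

lemma latNorm_eq_norm {d : ℕ} (r : Fin d → ℤ) :
    latNorm r = ‖WithLp.toLp 2 (fun i => (r i : ℝ))‖ := by
  simp [latNorm, EuclideanSpace.norm_eq]

lemma latNorm_nonneg {d : ℕ} (r : Fin d → ℤ) : 0 ≤ latNorm r := Real.sqrt_nonneg _

lemma latDist_triangle {d : ℕ} (x y z : Fin d → ℤ) :
    latDist x z ≤ latDist x y + latDist y z := by
  simp only [latDist, latNorm_eq_norm]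
  refine le_of_eq_of_le (congrArg norm ?_) (norm_add_le _ _)
  ext i
  simp

lemma summable_latNorm_rpow {d : ℕ} {α : ℝ} (hα : (d : ℝ) < α) :
    Summable fun r : Fin d → ℤ => latNorm r ^ (-α) := by
  let b := (EuclideanSpace.basisFun (Fin d) ℝ).toBasis
  let bL := b.restrictScalars ℤ
  have hfin : Module.finrank ℤ (Submodule.span ℤ (Set.range b)) = d := by
    rw [Module.finrank_eq_card_basis bL, Fintype.card_fin]
  have h := ZLattice.summable_norm_rpow (Submodule.span ℤ (Set.range b)) (-α)
    (by rw [hfin]; linarith)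
  refine (bL.equivFun.symm.toEquiv.summable_iff.mpr h).congr fun r => ?_
  have hr : ((bL.equivFun.symm r : Submodule.span ℤ (Set.range b)) : EuclideanSpace ℝ (Fin d)) =
      WithLp.toLp 2 (fun i => (r i : ℝ)) := by
    have hsum : ((bL.equivFun.symm r : Submodule.span ℤ (Set.range b)) :
        EuclideanSpace ℝ (Fin d)) = ∑ i, r i • b i := by
      rw [Module.Basis.equivFun_symm_apply, ← Submodule.subtype_apply, map_sum]
      refine Finset.sum_congr rfl fun i _ => ?_
      rw [map_smul, Submodule.subtype_apply, Module.Basis.restrictScalars_apply]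
    rw [hsum]
    ext i
    simp [b, Pi.single_apply]
  simp [latNorm_eq_norm, ← hr]

lemma summable_latNorm_add_one_rpow {d : ℕ} {α : ℝ} (hα : (d : ℝ) < α) :
    Summable fun r : Fin d → ℤ => ((latNorm r + 1) ^ α)⁻¹ := by
  have hα0 : 0 < α := lt_of_le_of_lt (Nat.cast_nonneg d) hα
  refine Summable.of_norm_bounded_eventually (summable_latNorm_rpow hα) ?_
  refine (Set.finite_singleton (0 : Fin d → ℤ)).subset fun r hr => ?_
  by_contra hne
  refine hr ?_
  have hpos : 0 < latNorm r := by
    rw [latNorm_eq_norm, norm_pos_iff]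
    intro h0
    refine hne (funext fun i => ?_)
    simpa using congrFun (congrArg WithLp.ofLp h0) i
  rw [Set.mem_ofPred_eq, Real.norm_of_nonneg (by positivity), Real.rpow_neg hpos.le]
  gcongr
  linarith

/-- The truncated exponential is dominated by an algebraic decay at scale `ξ + 1`. -/
lemma min_exp_sub_one_le {α ξ t : ℝ} (hα : 1 ≤ α) (hξ : 0 ≤ ξ) (ht : 0 ≤ t) :
    min (Real.exp (ξ - t)) 1 ≤
      α ^ α * Real.exp 1 * ((ξ + 1) ^ α * ((t + 1) ^ α)⁻¹) := by
  have hα0 : 0 < α := by linarith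
  rw [← mul_assoc, ← div_eq_mul_inv, le_div_iff₀ (by positivity)]
  rcases le_total t ξ with h | h
  · calc min (Real.exp (ξ - t)) 1 * (t + 1) ^ α ≤ 1 * (ξ + 1) ^ α := by
          gcongr
          exact min_le_right _ _
      _ ≤ α ^ α * Real.exp 1 * (ξ + 1) ^ α := by
          gcongr
          exact one_le_mul_of_one_le_of_one_le (Real.one_le_rpow hα hα0.le)
            (Real.one_le_exp zero_le_one)
  · have hy : (1 + (t - ξ)) ^ α ≤ α ^ α * Real.exp (1 + (t - ξ)) := by
      have hz : 1 + (t - ξ) ≤ α * Real.exp ((1 + (t - ξ)) / α) := by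
        rw [← div_le_iff₀' hα0]
        linarith [Real.add_one_le_exp ((1 + (t - ξ)) / α)]
      calc (1 + (t - ξ)) ^ α ≤ (α * Real.exp ((1 + (t - ξ)) / α)) ^ α := by
            gcongr
        _ = _ := by
            rw [Real.mul_rpow hα0.le (Real.exp_pos _).le, ← Real.exp_mul,
              div_mul_cancel₀ _ hα0.ne']
    calc min (Real.exp (ξ - t)) 1 * (t + 1) ^ α
        ≤ Real.exp (ξ - t) * ((ξ + 1) * (1 + (t - ξ))) ^ α := by
          gcongr
          · exact min_le_left _ _
          · nlinarith
      _ = Real.exp (ξ - t) * ((ξ + 1) ^ α * (1 + (t - ξ)) ^ α) := by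
          rw [Real.mul_rpow (by linarith) (by linarith)]
      _ ≤ Real.exp (ξ - t) * ((ξ + 1) ^ α * (α ^ α * Real.exp (1 + (t - ξ)))) := by
          gcongr
      _ = α ^ α * (Real.exp (ξ - t) * Real.exp (1 + (t - ξ))) * (ξ + 1) ^ α := by ring
      _ = α ^ α * Real.exp 1 * (ξ + 1) ^ α := by
          rw [← Real.exp_add]
          ring_nf

/-- Two algebraic decays convolve termwise into an algebraic decay at the total distance. -/
lemma inv_rpow_mul_inv_rpow_le {α u v s : ℝ} (hα : 0 ≤ α) (hu : 0 < u) (hv : 0 < v)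
    (hs : 0 < s) (h : s ≤ u + v) :
    (u ^ α)⁻¹ * (v ^ α)⁻¹ ≤ ((s / 2) ^ α)⁻¹ * ((u ^ α)⁻¹ + (v ^ α)⁻¹) := by
  have key : ∀ {a b : ℝ}, 0 < a → 0 < b → s / 2 ≤ a →
      (a ^ α)⁻¹ * (b ^ α)⁻¹ ≤ ((s / 2) ^ α)⁻¹ * ((a ^ α)⁻¹ + (b ^ α)⁻¹) := by
    intro a b ha hb hab
    have : (b ^ α)⁻¹ ≤ (a ^ α)⁻¹ + (b ^ α)⁻¹ := le_add_of_nonneg_left (by positivity)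
    gcongr
  rcases le_total v u with huv | huv
  · exact key hu hv (by linarith)
  · rw [mul_comm (u ^ α)⁻¹, add_comm (u ^ α)⁻¹]
    exact key hv hu (by linarith)

/-- **Bound on the convolution of exponential and algebraic decays** (Proposition S1):
for every `d ≥ 1` and `α > d` there is a constant `c` depending only on `α` and `d`
such that for all `ξ > α - 1` and all `R₁, R₂ ∈ ℤ^d`,
`∑_R min{e^{ξ-|R-R₂|},1}/(|R₁-R|+1)^α ≤ c min{(4(ξ+1)/(|R₁-R₂|+1))^α, 1}`. -/
theorem convolution_exponential_algebraic (d : ℕ) (hd : 1 ≤ d) (α : ℝ) (hα : (d : ℝ) < α) :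
    ∃ c : ℝ, 0 < c ∧
      ∀ (ξ : ℝ), α - 1 < ξ → ∀ R₁ R₂ : Fin d → ℤ,
        (∑' R : Fin d → ℤ,
            min (Real.exp (ξ - latDist R R₂)) 1 / (latDist R₁ R + 1) ^ α) ≤
          c * min ((4 * (ξ + 1) / (latDist R₁ R₂ + 1)) ^ α) 1 := by
  have hα1 : 1 ≤ α := by
    have : (1 : ℝ) ≤ d := by exact_mod_cast hd
    linarith
  have hα0 : 0 < α := by linarith
  obtain ⟨g, hg⟩ : ∃ g : (Fin d → ℤ) → ℝ, g = fun r => ((latNorm r + 1) ^ α)⁻¹ := ⟨_, rfl⟩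
  have hg0 : ∀ r, 0 < g r := fun r => by
    have := latNorm_nonneg r
    rw [hg]
    positivity
  have hsum : Summable g := hg ▸ summable_latNorm_add_one_rpow hα
  set S := ∑' r, g r
  have hS0 : 0 < S := hsum.tsum_pos (fun r => (hg0 r).le) 0 (hg0 0)
  set K := α ^ α * Real.exp 1
  have hK0 : 0 < K := by positivity
  refine ⟨S + 2 * K * S, by positivity, fun ξ hξ R₁ R₂ => ?_⟩
  have hξ0 : 0 ≤ ξ := by linarith
  have hs : 0 < latDist R₁ R₂ + 1 := by linarith [show 0 ≤ latDist R₁ R₂ from latNorm_nonneg _]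
  set s := latDist R₁ R₂ + 1
  have hsum₁ : HasSum (fun R => g (R₁ - R)) S :=
    (Equiv.subLeft R₁).hasSum_iff.mpr hsum.hasSum
  have hsum₂ : HasSum (fun R => g (R - R₂)) S :=
    (Equiv.subRight R₂).hasSum_iff.mpr hsum.hasSum
  have hgR₁ : ∀ R, g (R₁ - R) = ((latDist R₁ R + 1) ^ α)⁻¹ := fun R => by rw [hg, latDist]
  have hgR₂ : ∀ R, g (R - R₂) = ((latDist R R₂ + 1) ^ α)⁻¹ := fun R => by rw [hg, latDist]
  simp only [div_eq_mul_inv _ ((latDist R₁ _ + 1) ^ α), ← hgR₁]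
  set f : (Fin d → ℤ) → ℝ := fun R => min (Real.exp (ξ - latDist R R₂)) 1 * g (R₁ - R)
  have hf0 : ∀ R, 0 ≤ f R := fun R => mul_nonneg (by positivity) (hg0 _).le
  have hf₁ : ∀ R, f R ≤ g (R₁ - R) := fun R =>
    mul_le_of_le_one_left (hg0 _).le (min_le_right _ _)
  have hfs : Summable f := .of_nonneg_of_le hf0 hf₁ hsum₁.summable
  have hle₁ : ∑' R, f R ≤ S := hasSum_le hf₁ hfs.hasSum hsum₁
  have hf₂ : ∀ R, f R ≤ K * (ξ + 1) ^ α * ((s / 2) ^ α)⁻¹ * (g (R₁ - R) + g (R - R₂)) :=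
    fun R => by
    have h1 : 0 ≤ latDist R₁ R := latNorm_nonneg _
    have h2 : 0 ≤ latDist R R₂ := latNorm_nonneg _
    calc f R = min (Real.exp (ξ - latDist R R₂)) 1 * g (R₁ - R) := rfl
      _ ≤ K * ((ξ + 1) ^ α * g (R - R₂)) * g (R₁ - R) :=
          mul_le_mul_of_nonneg_right (hgR₂ R ▸ min_exp_sub_one_le hα1 hξ0 h2) (hg0 _).le
      _ = K * (ξ + 1) ^ α * (g (R₁ - R) * g (R - R₂)) := by ring
      _ ≤ K * (ξ + 1) ^ α * (((s / 2) ^ α)⁻¹ * (g (R₁ - R) + g (R - R₂))) := by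
          refine mul_le_mul_of_nonneg_left ?_ (by positivity)
          rw [hgR₁, hgR₂]
          refine inv_rpow_mul_inv_rpow_le (u := latDist R₁ R + 1) (v := latDist R R₂ + 1)
            hα0.le (by linarith) (by linarith) hs ?_
          linarith [latDist_triangle R₁ R R₂]
      _ = _ := by ring
  have hle₂ : ∑' R, f R ≤ 2 * K * S * (4 * (ξ + 1) / s) ^ α := by
    calc ∑' R, f R ≤ K * (ξ + 1) ^ α * ((s / 2) ^ α)⁻¹ * (S + S) :=
          hasSum_le hf₂ hfs.hasSum ((hsum₁.add hsum₂).mul_left _)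
      _ = 2 * K * S * ((ξ + 1) / (s / 2)) ^ α := by
          rw [Real.div_rpow (x := ξ + 1) (by linarith) (by positivity), div_eq_mul_inv ((ξ + 1) ^ α)]
          generalize ((s / 2) ^ α)⁻¹ = p
          ring
      _ ≤ 2 * K * S * (4 * (ξ + 1) / s) ^ α := by
          rw [div_div_eq_mul_div, mul_comm (ξ + 1)]
          gcongr
          norm_num
  have hpow : 0 ≤ (4 * (ξ + 1) / s) ^ α := by positivity
  rcases min_choice ((4 * (ξ + 1) / s) ^ α) 1 with h | h <;> rw [h]
  · nlinarith [mul_nonneg hS0.le hpow]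
  · nlinarith [mul_pos hK0 hS0]

end
end

section
/- Fourier transform of the error-function filter: For every σ > 0 and every ω ∈ ℝ, (1/π) ∫_{−∞}^{∞} (sin(ω t)/t) · e^{−σ² t² / 4} dt = erf(ω/σ), where the integrand is extended by its limit ω at t = 0 and is Lebesgue integrable on ℝ. -/
noncomputable section

/-- The error function `erf(x) = (2/√π) ∫₀ˣ e^{-u²} du`. -/
def erf (x : ℝ) : ℝ := (2 / Real.sqrt Real.pi) * ∫ u in (0 : ℝ)..x, Real.exp (-u ^ 2)

/-- The real form of the Fourier transform of a Gaussian. -/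
theorem integral_cos_mul_exp_neg_mul_sq {b : ℝ} (hb : 0 < b) (s : ℝ) :
    ∫ t : ℝ, Real.cos (s * t) * Real.exp (-b * t ^ 2) =
      Real.sqrt (Real.pi / b) * Real.exp (-s ^ 2 / (4 * b)) := by
  have hint : MeasureTheory.Integrable fun t : ℝ =>
      Complex.exp (Complex.I * s * t) * Complex.exp (-(b : ℂ) * (t : ℂ) ^ 2) := by
    refine (integrable_cexp_quadratic (b := (b : ℂ)) (by simpa using hb)
      (Complex.I * s) 0).congr (.of_forall fun t => ?_)
    simp only [← Complex.exp_add]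
    ring_nf
  have hre (t : ℝ) : (Complex.exp (Complex.I * s * t) * Complex.exp (-(b : ℂ) * (t : ℂ) ^ 2)).re =
      Real.cos (s * t) * Real.exp (-b * t ^ 2) := by
    have h₁ : Complex.I * s * t = ((s * t : ℝ) : ℂ) * Complex.I := by push_cast; ring
    have h₂ : -(b : ℂ) * (t : ℂ) ^ 2 = ((-b * t ^ 2 : ℝ) : ℂ) := by push_cast; ring
    rw [h₁, h₂, ← Complex.ofReal_exp, Complex.re_mul_ofReal, Complex.exp_ofReal_mul_I_re]
  have hvalue : ((Real.pi : ℂ) / b) ^ (1 / 2 : ℂ) * Complex.exp (-(s : ℂ) ^ 2 / (4 * b)) =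
      ((Real.sqrt (Real.pi / b) * Real.exp (-s ^ 2 / (4 * b)) : ℝ) : ℂ) := by
    rw [Real.sqrt_eq_rpow, Complex.ofReal_mul, Complex.ofReal_cpow (by positivity)]
    push_cast
    rfl
  have h := fourierIntegral_gaussian (b := (b : ℂ)) (by simpa using hb) s
  rw [hvalue] at h
  have h' := integral_re hint
  simp only [RCLike.re_eq_complex_re, hre] at h'
  rw [h', h, Complex.ofReal_re]

theorem ite_sin_div_eq_mul_sinc (ω t : ℝ) :
    (if t = 0 then ω else Real.sin (ω * t) / t) = ω * Real.sinc (ω * t) := by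
  rcases eq_or_ne t 0 with rfl | ht
  · simp
  rcases eq_or_ne ω 0 with rfl | hω
  · simp
  rw [if_neg ht, Real.sinc_of_ne_zero (mul_ne_zero hω ht)]
  field_simp

theorem integral_cos_mul_eq_ite_sin_div (ω t : ℝ) :
    ∫ s in (0 : ℝ)..ω, Real.cos (s * t) = if t = 0 then ω else Real.sin (ω * t) / t := by
  split_ifs with ht
  · simp [ht]
  · rw [intervalIntegral.integral_comp_mul_right _ ht]
    simp [div_eq_inv_mul]

theorem integrable_ite_sin_div_mul_exp_neg_mul_sq {b : ℝ} (hb : 0 < b) (ω : ℝ) :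
    MeasureTheory.Integrable fun t : ℝ =>
      (if t = 0 then ω else Real.sin (ω * t) / t) * Real.exp (-b * t ^ 2) := by
  simp only [ite_sin_div_eq_mul_sinc]
  refine (integrable_exp_neg_mul_sq hb).bdd_mul (c := |ω|) ?_ (.of_forall fun t => ?_)
  · exact (continuous_const.mul
      (Real.continuous_sinc.comp (continuous_const.mul continuous_id))).aestronglyMeasurable
  · rw [Real.norm_eq_abs, abs_mul]
    exact mul_le_of_le_one_right (abs_nonneg ω) (Real.abs_sinc_le_one _)

theorem integral_ite_sin_div_mul_exp_neg_mul_sq {b : ℝ} (hb : 0 < b) (ω : ℝ) :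
    ∫ t : ℝ, (if t = 0 then ω else Real.sin (ω * t) / t) * Real.exp (-b * t ^ 2) =
      Real.sqrt (Real.pi / b) * ∫ s in (0 : ℝ)..ω, Real.exp (-s ^ 2 / (4 * b)) := by
  have hint : MeasureTheory.Integrable
      (Function.uncurry fun s t : ℝ => Real.cos (s * t) * Real.exp (-b * t ^ 2))
      ((MeasureTheory.volume.restrict (Set.uIoc 0 ω)).prod MeasureTheory.volume) := by
    have hone : MeasureTheory.Integrable (fun _ : ℝ => (1 : ℝ))
        (MeasureTheory.volume.restrict (Set.uIoc 0 ω)) :=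
      intervalIntegrable_iff.mp intervalIntegrable_const
    refine (hone.mul_prod (integrable_exp_neg_mul_sq hb)).mono
      (Continuous.aestronglyMeasurable (by fun_prop)) (.of_forall fun z => ?_)
    simp only [Function.uncurry, norm_mul, norm_one]
    exact mul_le_mul_of_nonneg_right (Real.abs_cos_le_one _) (norm_nonneg _)
  simp only [← integral_cos_mul_eq_ite_sin_div, ← intervalIntegral.integral_mul_const]
  rw [← MeasureTheory.intervalIntegral_integral_swap hint]
  simp only [integral_cos_mul_exp_neg_mul_sq hb, intervalIntegral.integral_const_mul]

/-- **Fourier transform of the error-function filter**: for every `σ > 0` and `ω ∈ ℝ`,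
`(1/π) ∫ (sin(ωt)/t) e^{-σ²t²/4} dt = erf(ω/σ)`, where the integrand is extended by its
limit `ω` at `t = 0` and is Lebesgue integrable on `ℝ`. -/
theorem fourier_transform_erf_filter (σ ω : ℝ) (hσ : 0 < σ) :
    MeasureTheory.Integrable
      (fun t : ℝ => (if t = 0 then ω else Real.sin (ω * t) / t) * Real.exp (-σ ^ 2 * t ^ 2 / 4)) ∧
    (1 / Real.pi) *
        ∫ t : ℝ, (if t = 0 then ω else Real.sin (ω * t) / t) * Real.exp (-σ ^ 2 * t ^ 2 / 4) =
      erf (ω / σ) := by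
  have hb : 0 < σ ^ 2 / 4 := by positivity
  have hexp (t : ℝ) : -σ ^ 2 * t ^ 2 / 4 = -(σ ^ 2 / 4) * t ^ 2 := by ring
  simp only [hexp]
  refine ⟨integrable_ite_sin_div_mul_exp_neg_mul_sq hb ω, ?_⟩
  have hscale (s : ℝ) : -s ^ 2 / (4 * (σ ^ 2 / 4)) = -(s / σ) ^ 2 := by field_simp
  have hsqrt : Real.sqrt (Real.pi / (σ ^ 2 / 4)) = 2 * Real.sqrt Real.pi / σ := by
    rw [Real.sqrt_eq_iff_mul_self_eq (by positivity) (by positivity)]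
    field_simp
    rw [Real.sq_sqrt Real.pi_pos.le]
    ring
  rw [integral_ite_sin_div_mul_exp_neg_mul_sq hb, hsqrt, erf]
  simp only [hscale]
  rw [intervalIntegral.integral_comp_div (fun u => Real.exp (-u ^ 2)) hσ.ne', zero_div, smul_eq_mul]
  field_simp
  rw [Real.sq_sqrt Real.pi_pos.le]

end
end

section
/- Fourier transform of the Green's-function filter: For every a ∈ ℝ and every ω ∈ ℝ with ω ≠ 0, (i/2) ∫_{−∞}^{∞} (erf(t/2 − a) − sgn(t)) · e^{−i ω t} dt = −(1 − e^{−ω(ω + 2 i a)})/ω, where the integrand is Lebesgue integrable on ℝ (it decays super-exponentially as t → ±∞). -/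
noncomputable section

open MeasureTheory Filter Topology Set

theorem erf_neg (x : ℝ) : erf (-x) = -erf x := by
  have h := intervalIntegral.integral_comp_neg (a := 0) (b := x) fun u : ℝ => Real.exp (-u ^ 2)
  simp only [neg_sq, neg_zero] at h
  rw [erf, erf, h, intervalIntegral.integral_symm, mul_neg]

theorem hasDerivAt_erf (x : ℝ) :
    HasDerivAt erf (2 / Real.sqrt Real.pi * Real.exp (-x ^ 2)) x := by
  have hc : Continuous fun u : ℝ => Real.exp (-u ^ 2) := by fun_prop
  exact (hc.integral_hasStrictDerivAt 0 x).hasDerivAt.const_mul _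

theorem continuous_erf : Continuous erf :=
  continuous_iff_continuousAt.2 fun x => (hasDerivAt_erf x).continuousAt

theorem tendsto_erf_atTop : Tendsto erf atTop (𝓝 1) := by
  have hi : Integrable fun u : ℝ => Real.exp (-u ^ 2) := by
    simpa using integrable_exp_neg_mul_sq one_pos
  have h := (intervalIntegral_tendsto_integral_Ioi 0 hi.integrableOn tendsto_id).const_mul
    (2 / Real.sqrt Real.pi)
  have hg : ∫ u in Ioi (0 : ℝ), Real.exp (-u ^ 2) = Real.sqrt Real.pi / 2 := by
    simpa using integral_gaussian_Ioi 1
  have hpi : Real.sqrt Real.pi ≠ 0 := (Real.sqrt_pos.2 Real.pi_pos).ne'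
  rw [hg, div_mul_div_cancel₀ hpi, div_self two_ne_zero] at h
  exact h

theorem erf_le_one (x : ℝ) : erf x ≤ 1 := by
  refine Monotone.ge_of_tendsto (monotone_of_deriv_nonneg
    (fun x => (hasDerivAt_erf x).differentiableAt) fun x => ?_) tendsto_erf_atTop x
  rw [(hasDerivAt_erf x).deriv]
  positivity

theorem one_sub_erf_le (x : ℝ) :
    1 - erf x ≤ 1 / Real.sqrt Real.pi * Real.exp (1 - 2 * x) := by
  have hd (x : ℝ) : HasDerivAt
      (fun x => 1 / Real.sqrt Real.pi * Real.exp (1 - 2 * x) + erf x)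
      (2 / Real.sqrt Real.pi * (Real.exp (-x ^ 2) - Real.exp (1 - 2 * x))) x := by
    refine ((((((hasDerivAt_id' x).const_mul 2).const_sub 1).exp).const_mul
      (1 / Real.sqrt Real.pi)).add (hasDerivAt_erf x)).congr_deriv ?_
    ring
  have ht : Tendsto (fun x => 1 / Real.sqrt Real.pi * Real.exp (1 - 2 * x) + erf x) atTop
      (𝓝 (1 / Real.sqrt Real.pi * 0 + 1)) := by
    refine ((Real.tendsto_exp_atBot.comp ?_).const_mul _).add tendsto_erf_atTop
    exact tendsto_atBot_add_const_left _ 1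
      (tendsto_neg_atTop_atBot.comp (tendsto_id.const_mul_atTop two_pos))
  have ha : Antitone fun x => 1 / Real.sqrt Real.pi * Real.exp (1 - 2 * x) + erf x := by
    refine antitone_of_deriv_nonpos (fun x => (hd x).differentiableAt) fun x => ?_
    rw [(hd x).deriv]
    refine mul_nonpos_of_nonneg_of_nonpos (by positivity) (sub_nonpos.2 (Real.exp_le_exp.2 ?_))
    nlinarith [sq_nonneg (x - 1)]
  have := ha.le_of_tendsto ht x
  simp only [mul_zero, zero_add] at this
  linarith

theorem abs_erf_sub_one_le (x : ℝ) :
    |erf x - 1| ≤ 1 / Real.sqrt Real.pi * Real.exp (1 - 2 * x) := by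
  rw [abs_sub_comm, abs_of_nonneg (sub_nonneg.2 (erf_le_one x))]
  exact one_sub_erf_le x

theorem abs_erf_add_one_le (x : ℝ) :
    |erf x + 1| ≤ 1 / Real.sqrt Real.pi * Real.exp (1 + 2 * x) := by
  have h := abs_erf_sub_one_le (-x)
  rwa [erf_neg, ← neg_add', abs_neg, mul_neg, sub_neg_eq_add] at h

theorem tendsto_erf_atBot : Tendsto erf atBot (𝓝 (-1)) := by
  have h := (tendsto_erf_atTop.comp tendsto_neg_atBot_atTop).neg
  simpa [Function.comp_def, erf_neg] using h

theorem norm_cexp_neg_I_mul (ω t : ℝ) : ‖Complex.exp (-Complex.I * ω * t)‖ = 1 := by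
  simp [Complex.norm_exp]

theorem integrableOn_erf_sub_one_mul_cexp (a ω : ℝ) :
    IntegrableOn (fun t : ℝ => ((erf (t / 2 - a) - 1 : ℝ) : ℂ) *
      Complex.exp (-Complex.I * ω * t)) (Ioi 0) := by
  have hc := continuous_erf
  refine ((integrableOn_exp_mul_Ioi (a := -1) (by norm_num) 0).const_mul
    (1 / Real.sqrt Real.pi * Real.exp (1 + 2 * a))).mono'
    (Continuous.aestronglyMeasurable (by fun_prop)) (ae_of_all _ fun t => ?_)
  rw [norm_mul, norm_cexp_neg_I_mul, mul_one, Complex.norm_real, Real.norm_eq_abs, mul_assoc,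
    ← Real.exp_add]
  convert abs_erf_sub_one_le (t / 2 - a) using 3
  ring

theorem integrableOn_erf_add_one_mul_cexp (a ω : ℝ) :
    IntegrableOn (fun t : ℝ => ((erf (t / 2 - a) + 1 : ℝ) : ℂ) *
      Complex.exp (-Complex.I * ω * t)) (Iic 0) := by
  have hc := continuous_erf
  refine ((integrableOn_exp_mul_Iic (a := 1) (by norm_num) 0).const_mul
    (1 / Real.sqrt Real.pi * Real.exp (1 - 2 * a))).mono'
    (Continuous.aestronglyMeasurable (by fun_prop)) (ae_of_all _ fun t => ?_)
  rw [norm_mul, norm_cexp_neg_I_mul, mul_one, Complex.norm_real, Real.norm_eq_abs, mul_assoc,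
    ← Real.exp_add]
  convert abs_erf_add_one_le (t / 2 - a) using 3
  ring

/-- The product of `e^{-iωt}` and the derivative of `t ↦ erf (t / 2 - a)`. -/
def derivErfMulExp (a ω t : ℝ) : ℂ :=
  ((1 / Real.sqrt Real.pi * Real.exp (-(t / 2 - a) ^ 2) : ℝ) : ℂ) *
    Complex.exp (-Complex.I * ω * t)

theorem derivErfMulExp_eq (a ω t : ℝ) :
    derivErfMulExp a ω t = ((1 / Real.sqrt Real.pi : ℝ) : ℂ) *
      Complex.exp ((-1 / 4 : ℂ) * t ^ 2 + (a - Complex.I * ω) * t + (-a ^ 2)) := by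
  rw [derivErfMulExp, Complex.ofReal_mul, Complex.ofReal_exp, mul_assoc, ← Complex.exp_add]
  congr 2
  push_cast
  ring

theorem integrable_derivErfMulExp (a ω : ℝ) : Integrable (derivErfMulExp a ω) := by
  simp only [funext (derivErfMulExp_eq a ω)]
  exact (integrable_cexp_quadratic' (by norm_num) _ _).const_mul _

theorem integral_derivErfMulExp (a ω : ℝ) :
    ∫ t, derivErfMulExp a ω t =
      2 * Complex.exp (-(ω : ℂ) * ((ω : ℂ) + 2 * Complex.I * (a : ℂ))) := by
  simp only [derivErfMulExp_eq]
  rw [integral_const_mul, integral_cexp_quadratic (by norm_num)]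
  have hs : (Real.pi / -(-1 / 4 : ℂ)) ^ (1 / 2 : ℂ) = ((2 * Real.sqrt Real.pi : ℝ) : ℂ) := by
    have h2 : 2 * Real.sqrt Real.pi = (4 * Real.pi) ^ (1 / 2 : ℝ) := by
      rw [← Real.sqrt_eq_rpow, Real.sqrt_mul (by norm_num), show (4 : ℝ) = 2 ^ 2 by norm_num,
        Real.sqrt_sq two_pos.le]
    rw [h2, Complex.ofReal_cpow (by positivity)]
    push_cast
    congr 1
    ring
  have hpi : Real.sqrt Real.pi ≠ 0 := (Real.sqrt_pos.2 Real.pi_pos).ne'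
  rw [hs, ← mul_assoc, ← Complex.ofReal_mul]
  congr 1
  · rw [show 1 / Real.sqrt Real.pi * (2 * Real.sqrt Real.pi) = 2 by field_simp]
    norm_num
  · congr 1
    ring_nf
    rw [Complex.I_sq]
    ring

theorem hasDerivAt_erf_add_mul_cexp (a ω c t : ℝ) (hω : ω ≠ 0) :
    HasDerivAt (fun t : ℝ => ((erf (t / 2 - a) + c : ℝ) : ℂ) *
        Complex.exp (-Complex.I * ω * t) * (Complex.I / ω))
      (((erf (t / 2 - a) + c : ℝ) : ℂ) * Complex.exp (-Complex.I * ω * t) +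
        derivErfMulExp a ω t * (Complex.I / ω)) t := by
  have h1 : HasDerivAt (fun t : ℝ => erf (t / 2 - a) + c)
      (1 / Real.sqrt Real.pi * Real.exp (-(t / 2 - a) ^ 2)) t := by
    refine (((hasDerivAt_erf (t / 2 - a)).comp t
      (((hasDerivAt_id' t).div_const 2).sub_const a)).add_const c).congr_deriv ?_
    ring
  have h2 : HasDerivAt (fun t : ℝ => Complex.exp (-Complex.I * ω * t))
      (Complex.exp (-Complex.I * ω * t) * (-Complex.I * ω * 1)) t :=
    ((Complex.ofRealCLM.hasDerivAt (x := t)).const_mul (-Complex.I * ω)).cexp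
  refine ((h1.ofReal_comp.mul h2).mul_const (Complex.I / ω)).congr_deriv ?_
  have hω' : (ω : ℂ) ≠ 0 := Complex.ofReal_ne_zero.2 hω
  have hI : -Complex.I * ω * 1 * (Complex.I / ω) = 1 := by
    field_simp
    rw [Complex.I_sq, neg_neg]
  rw [derivErfMulExp, add_mul, mul_assoc, mul_assoc (Complex.ofReal _) (_ * _) (Complex.I / ω),
    mul_assoc (Complex.exp _) (-Complex.I * ω * 1), hI, mul_one, mul_assoc, add_comm]

theorem tendsto_mul_cexp_mul_zero {l : Filter ℝ} {f : ℝ → ℝ} (hf : Tendsto f l (𝓝 0))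
    (ω : ℝ) (c : ℂ) :
    Tendsto (fun t : ℝ => (f t : ℂ) * Complex.exp (-Complex.I * ω * t) * c) l (𝓝 0) := by
  rw [tendsto_zero_iff_norm_tendsto_zero]
  simp only [norm_mul, norm_cexp_neg_I_mul, mul_one, Complex.norm_real]
  simpa using hf.norm.mul_const ‖c‖

theorem integral_Ioi_erf_sub_one_mul_cexp (a ω : ℝ) (hω : ω ≠ 0) :
    ∫ t in Ioi (0 : ℝ), ((erf (t / 2 - a) - 1 : ℝ) : ℂ) * Complex.exp (-Complex.I * ω * t) =
      -((erf (-a) - 1 : ℝ) : ℂ) * (Complex.I / ω) -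
        (∫ t in Ioi (0 : ℝ), derivErfMulExp a ω t) * (Complex.I / ω) := by
  have hi := integrableOn_erf_sub_one_mul_cexp a ω
  have hg := ((integrable_derivErfMulExp a ω).mul_const (Complex.I / ω)).integrableOn (s := Ioi 0)
  have ht : Tendsto (fun t : ℝ => erf (t / 2 - a) + -1) atTop (𝓝 0) := by
    have := (tendsto_erf_atTop.comp (tendsto_atTop_add_const_right _ (-a)
      (tendsto_id.atTop_div_const two_pos))).add_const (-1)
    simpa [Function.comp_def, sub_eq_add_neg] using this
  have h := integral_Ioi_of_hasDerivAt_of_tendsto'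
    (fun t _ => hasDerivAt_erf_add_mul_cexp a ω (-1) t hω) (hi.add hg)
    (tendsto_mul_cexp_mul_zero ht ω _)
  simp only [← sub_eq_add_neg] at h
  rw [integral_add hi hg, integral_mul_const] at h
  rw [eq_sub_iff_add_eq, h]
  simp
  ring

theorem integral_Iic_erf_add_one_mul_cexp (a ω : ℝ) (hω : ω ≠ 0) :
    ∫ t in Iic (0 : ℝ), ((erf (t / 2 - a) + 1 : ℝ) : ℂ) * Complex.exp (-Complex.I * ω * t) =
      ((erf (-a) + 1 : ℝ) : ℂ) * (Complex.I / ω) -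
        (∫ t in Iic (0 : ℝ), derivErfMulExp a ω t) * (Complex.I / ω) := by
  have hi := integrableOn_erf_add_one_mul_cexp a ω
  have hg := ((integrable_derivErfMulExp a ω).mul_const (Complex.I / ω)).integrableOn (s := Iic 0)
  have ht : Tendsto (fun t : ℝ => erf (t / 2 - a) + 1) atBot (𝓝 0) := by
    have := (tendsto_erf_atBot.comp (tendsto_atBot_add_const_right _ (-a)
      (tendsto_id.atBot_div_const two_pos))).add_const 1
    simpa [Function.comp_def, sub_eq_add_neg] using this
  have h := integral_Iic_of_hasDerivAt_of_tendsto'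
    (fun t _ => hasDerivAt_erf_add_mul_cexp a ω 1 t hω) (hi.add hg)
    (tendsto_mul_cexp_mul_zero ht ω _)
  rw [integral_add hi hg, integral_mul_const] at h
  rw [eq_sub_iff_add_eq, h]
  simp

/-- **Fourier transform of the Green's-function filter** (Proposition S3, core identity):
for every `a ∈ ℝ` and `ω ≠ 0`,
`(i/2) ∫ (erf(t/2 - a) - sgn(t)) e^{-iωt} dt = -(1 - e^{-ω(ω+2ia)})/ω`,
the integrand being Lebesgue integrable on `ℝ`. -/
theorem fourier_transform_greens_filter (a ω : ℝ) (hω : ω ≠ 0) :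
    MeasureTheory.Integrable
      (fun t : ℝ => ((erf (t / 2 - a) - Real.sign t : ℝ) : ℂ) *
        Complex.exp (-Complex.I * ω * t)) ∧
    (Complex.I / 2) *
        ∫ t : ℝ, ((erf (t / 2 - a) - Real.sign t : ℝ) : ℂ) * Complex.exp (-Complex.I * ω * t) =
      -(1 - Complex.exp (-(ω : ℂ) * ((ω : ℂ) + 2 * Complex.I * (a : ℂ)))) / (ω : ℂ) := by
  have hr : EqOn (fun t : ℝ => ((erf (t / 2 - a) - 1 : ℝ) : ℂ) * Complex.exp (-Complex.I * ω * t))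
      (fun t : ℝ => ((erf (t / 2 - a) - Real.sign t : ℝ) : ℂ) * Complex.exp (-Complex.I * ω * t))
      (Ioi 0) := fun t ht => by simp only [Real.sign_of_pos ht]
  have hl : (fun t : ℝ => ((erf (t / 2 - a) + 1 : ℝ) : ℂ) * Complex.exp (-Complex.I * ω * t))
      =ᵐ[volume.restrict (Iic 0)]
      fun t : ℝ => ((erf (t / 2 - a) - Real.sign t : ℝ) : ℂ) * Complex.exp (-Complex.I * ω * t) := by
    rw [← restrict_Iio_eq_restrict_Iic]
    refine (ae_restrict_iff' measurableSet_Iio).2 (ae_of_all _ fun t ht => ?_)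
    simp only [Real.sign_of_neg ht, sub_neg_eq_add]
  have hir := (integrableOn_erf_sub_one_mul_cexp a ω).congr_fun hr measurableSet_Ioi
  have hil := (integrableOn_erf_add_one_mul_cexp a ω).congr_fun_ae hl
  refine ⟨by simpa only [Iic_union_Ioi, integrableOn_univ] using hil.union hir, ?_⟩
  have hD := integral_derivErfMulExp a ω
  have hg := integrable_derivErfMulExp a ω
  rw [← intervalIntegral.integral_Iic_add_Ioi hg.integrableOn hg.integrableOn (b := 0)] at hD
  rw [← intervalIntegral.integral_Iic_add_Ioi hil hir, ← setIntegral_congr_fun measurableSet_Ioi hr,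
    ← integral_congr_ae hl, integral_Ioi_erf_sub_one_mul_cexp a ω hω,
    integral_Iic_erf_add_one_mul_cexp a ω hω]
  push_cast
  linear_combination (-(Complex.I / 2) * (Complex.I / ω)) * hD +
    (1 - Complex.exp (-(ω : ℂ) * ((ω : ℂ) + 2 * Complex.I * (a : ℂ)))) / (ω : ℂ) * Complex.I_sq

end
end

section
/- Gap along the second segment of the Dirac deformation path: Let Γ₀, Γ₁, …, Γ_d be Hermitian n × n complex matrices satisfying the Clifford relations Γ_μ Γ_ν + Γ_ν Γ_μ = 2 δ_{μν} · 1. For k ∈ ℝ^d with s(k) := √(Σ_{μ=1}^d sin² k_μ) > 0, let h_fD(k) = Σ_{μ=1}^d (sin k_μ / s(k)) Γ_μ and let h_Topo(k) = Σ_{μ=1}^d sin k_μ · Γ_μ − (Σ_{μ=1}^d cos k_μ − (d − 1)) Γ₀. Then for every λ ∈ [1/2, 1], (2(1 − λ) h_fD(k) + (2λ − 1) h_Topo(k))² ≥ (1/2) · 1 in the Loewner (positive-semidefinite) order. -/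
noncomputable section

open scoped Matrix ComplexOrder

/-- The square of a linear combination of Clifford generators is scalar. -/
lemma clifford_sum_mul_self {ι m : Type*} [Fintype ι] [DecidableEq ι] [Fintype m] [DecidableEq m]
    (Γ : ι → Matrix m m ℂ)
    (hcl : ∀ μ ν, Γ μ * Γ ν + Γ ν * Γ μ = if μ = ν then (2 : ℂ) • (1 : Matrix m m ℂ) else 0)
    (c : ι → ℂ) :
    (∑ μ, c μ • Γ μ) * (∑ μ, c μ • Γ μ) = (∑ μ, c μ ^ 2) • (1 : Matrix m m ℂ) := by
  have h1 : (∑ μ, c μ • Γ μ) * (∑ μ, c μ • Γ μ) = ∑ μ, ∑ ν, (c μ * c ν) • (Γ μ * Γ ν) := by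
    simp only [Finset.sum_mul_sum, smul_mul_smul_comm]
  have h2 : (∑ μ, c μ • Γ μ) * (∑ μ, c μ • Γ μ) = ∑ μ, ∑ ν, (c μ * c ν) • (Γ ν * Γ μ) := by
    rw [h1, Finset.sum_comm]
    simp only [mul_comm]
  have h3 : (2 : ℂ) • ((∑ μ, c μ • Γ μ) * (∑ μ, c μ • Γ μ)) =
      (2 : ℂ) • ((∑ μ, c μ ^ 2) • (1 : Matrix m m ℂ)) := by
    rw [two_smul]
    nth_rewrite 1 [h1]
    rw [h2]
    simp only [← Finset.sum_add_distrib, ← smul_add, hcl, smul_ite, smul_zero,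
      Finset.sum_ite_eq, Finset.mem_univ, if_true]
    rw [Finset.sum_smul, Finset.smul_sum]
    refine Finset.sum_congr rfl fun μ _ => ?_
    rw [smul_smul, smul_smul]
    congr 1
    ring
  exact smul_right_injective _ (two_ne_zero (α := ℂ)) h3

lemma one_add_sqrt_le_add_sqrt {x y : ℝ} (hx : 0 ≤ x) (hy : 0 ≤ y) (hxy : x + y ≤ 1) :
    1 + √(1 - (x + y)) ≤ √(1 - x) + √(1 - y) := by
  have hu := Real.sq_sqrt (show 0 ≤ 1 - x by linarith)
  have hv := Real.sq_sqrt (show 0 ≤ 1 - y by linarith)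
  have hw := Real.sq_sqrt (show 0 ≤ 1 - (x + y) by linarith)
  have hprod : √(1 - (x + y)) ≤ √(1 - x) * √(1 - y) := by
    rw [← Real.sqrt_mul (by linarith)]
    exact Real.sqrt_le_sqrt (by nlinarith [mul_nonneg hx hy])
  refine le_of_sq_le_sq ?_ (by positivity)
  nlinarith

lemma card_sub_one_add_sqrt_le_sum_cos {ι : Type*} (k : ι → ℝ) (S : Finset ι)
    (hcos : ∀ i ∈ S, 0 ≤ Real.cos (k i)) (hsin : ∑ i ∈ S, Real.sin (k i) ^ 2 ≤ 1) :
    (S.card : ℝ) - 1 + √(1 - ∑ i ∈ S, Real.sin (k i) ^ 2) ≤ ∑ i ∈ S, Real.cos (k i) := by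
  classical
  induction S using Finset.induction_on with
  | empty => simp
  | insert j S hj ih =>
    rw [Finset.sum_insert hj] at hsin ⊢
    rw [Finset.sum_insert hj, Finset.card_insert_of_notMem hj]
    have hS : 0 ≤ ∑ i ∈ S, Real.sin (k i) ^ 2 := Finset.sum_nonneg fun _ _ => sq_nonneg _
    have h1 := ih (fun i hi => hcos i (Finset.mem_insert_of_mem hi))
      (by linarith [sq_nonneg (Real.sin (k j))])
    have h2 := one_add_sqrt_le_add_sqrt (sq_nonneg (Real.sin (k j))) hS hsin
    have h3 : √(1 - Real.sin (k j) ^ 2) = Real.cos (k j) := by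
      rw [← Real.cos_sq', Real.sqrt_sq (hcos j (Finset.mem_insert_self _ _))]
    push_cast
    linarith

/-- The topological Dirac Hamiltonian of mass `d - 1` has gap at least one. -/
lemma one_le_sum_sin_sq_add_mass_sq {ι : Type*} [Fintype ι] (k : ι → ℝ) :
    1 ≤ ∑ i, Real.sin (k i) ^ 2 +
      (∑ i, Real.cos (k i) - ((Fintype.card ι : ℝ) - 1)) ^ 2 := by
  classical
  rcases le_total 1 (∑ i, Real.sin (k i) ^ 2) with h | h
  · nlinarith [sq_nonneg (∑ i, Real.cos (k i) - ((Fintype.card ι : ℝ) - 1))]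
  have hw := Real.sq_sqrt (sub_nonneg.2 h)
  have hw0 := Real.sqrt_nonneg (1 - ∑ i, Real.sin (k i) ^ 2)
  by_cases hcos : ∀ i, 0 ≤ Real.cos (k i)
  · have := card_sub_one_add_sqrt_le_sum_cos k Finset.univ (fun i _ => hcos i) h
    rw [Finset.card_univ] at this
    nlinarith
  · push Not at hcos
    obtain ⟨j, hj⟩ := hcos
    have hsum : ∑ i ∈ Finset.univ.erase j, Real.cos (k i) ≤ (Fintype.card ι : ℝ) - 1 := by
      have := Finset.sum_le_card_nsmul (Finset.univ.erase j) (fun i => Real.cos (k i)) 1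
        fun i _ => Real.cos_le_one _
      rwa [Finset.card_erase_of_mem (Finset.mem_univ j), Finset.card_univ, nsmul_one,
        Nat.cast_pred (Fintype.card_pos_iff.2 ⟨j⟩)] at this
    have hadd := Finset.add_sum_erase Finset.univ (fun i => Real.cos (k i)) (Finset.mem_univ j)
    have hle : Real.sin (k j) ^ 2 ≤ ∑ i, Real.sin (k i) ^ 2 :=
      Finset.single_le_sum (f := fun i => Real.sin (k i) ^ 2) (fun _ _ => sq_nonneg _)
        (Finset.mem_univ j)
    have hcs := Real.sin_sq_add_cos_sq (k j)
    nlinarith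

/-- **Gap along the second segment of the Dirac deformation path** (Eq. (S55)):
if `Γ₀, Γ₁, …, Γ_d` are Hermitian matrices satisfying the Clifford relations, then for
`k` with `s(k) = √(Σ_μ sin² k_μ) > 0` and `λ ∈ [1/2, 1]`, the interpolation
`h_λ(k) = 2(1-λ) h_fD(k) + (2λ-1) h_Topo(k)` satisfies `h_λ(k)² ≥ (1/2)·1` in the
Loewner order, where `h_Topo(k) = Σ_μ sin k_μ Γ_μ - (Σ_μ cos k_μ - (d-1)) Γ₀`. -/
theorem dirac_path_second_segment (d n : ℕ) (hd : 1 ≤ d) (hn : 1 ≤ n)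
    (Γ0 : Matrix (Fin n) (Fin n) ℂ) (Γ : Fin d → Matrix (Fin n) (Fin n) ℂ)
    (hΓ0herm : Γ0.IsHermitian) (hΓherm : ∀ μ, (Γ μ).IsHermitian)
    (hcl00 : Γ0 * Γ0 = 1)
    (hcl0 : ∀ μ, Γ0 * Γ μ + Γ μ * Γ0 = 0)
    (hcl : ∀ μ ν, Γ μ * Γ ν + Γ ν * Γ μ = if μ = ν then (2 : ℂ) • (1 : Matrix (Fin n) (Fin n) ℂ) else 0)
    (k : Fin d → ℝ) (hk : 0 < Real.sqrt (∑ μ, Real.sin (k μ) ^ 2))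
    (lam : ℝ) (hlam : lam ∈ Set.Icc (1 / 2 : ℝ) 1) :
    ((((2 * (1 - lam) : ℝ) : ℂ) •
          ∑ μ, ((Real.sin (k μ) / Real.sqrt (∑ ν, Real.sin (k ν) ^ 2) : ℝ) : ℂ) • Γ μ +
        ((2 * lam - 1 : ℝ) : ℂ) •
          (∑ μ, ((Real.sin (k μ) : ℝ) : ℂ) • Γ μ -
            (((∑ μ, Real.cos (k μ)) - ((d : ℝ) - 1) : ℝ) : ℂ) • Γ0)) ^ 2 -
        ((1 / 2 : ℝ) : ℂ) • (1 : Matrix (Fin n) (Fin n) ℂ)).PosSemidef := by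
  obtain ⟨hl, hu⟩ := hlam
  have hgap := one_le_sum_sin_sq_add_mass_sq k
  rw [Fintype.card_fin] at hgap
  have hs2 := Real.sq_sqrt (Finset.sum_nonneg fun μ (_ : μ ∈ Finset.univ) =>
    sq_nonneg (Real.sin (k μ)))
  rw [← hs2] at hgap
  set s := √(∑ μ, Real.sin (k μ) ^ 2)
  set M := ∑ μ, Real.cos (k μ) - ((d : ℝ) - 1)
  set c : Fin d → ℝ := fun μ => (2 * (1 - lam) / s + (2 * lam - 1)) * Real.sin (k μ) with hc
  set r : ℝ := (2 * lam - 1) * M with hr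
  have hcsum : ∑ μ, (c μ : ℂ) ^ 2 = (((2 * (1 - lam) + (2 * lam - 1) * s) ^ 2 : ℝ) : ℂ) := by
    have : ∑ μ, c μ ^ 2 = (2 * (1 - lam) + (2 * lam - 1) * s) ^ 2 := by
      simp only [hc, mul_pow]
      rw [← Finset.mul_sum, ← hs2, ← mul_pow]
      field_simp
    exact_mod_cast this
  have hH : ((2 * (1 - lam) : ℝ) : ℂ) • ∑ μ, ((Real.sin (k μ) / s : ℝ) : ℂ) • Γ μ +
      ((2 * lam - 1 : ℝ) : ℂ) • (∑ μ, ((Real.sin (k μ) : ℝ) : ℂ) • Γ μ - (M : ℂ) • Γ0) =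
      ∑ μ, (c μ : ℂ) • Γ μ - (r : ℂ) • Γ0 := by
    rw [smul_sub, ← add_sub_assoc, Finset.smul_sum, Finset.smul_sum, ← Finset.sum_add_distrib,
      smul_smul, hr, Complex.ofReal_mul (2 * lam - 1) M]
    congr 1
    refine Finset.sum_congr rfl fun μ _ => ?_
    rw [smul_smul, smul_smul, ← add_smul]
    congr 1
    simp only [hc]
    push_cast
    ring
  have hanti : Γ0 * (∑ μ, (c μ : ℂ) • Γ μ) + (∑ μ, (c μ : ℂ) • Γ μ) * Γ0 = 0 := by
    rw [Finset.mul_sum, Finset.sum_mul, ← Finset.sum_add_distrib]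
    refine Finset.sum_eq_zero fun μ _ => ?_
    rw [mul_smul_comm, smul_mul_assoc, ← smul_add, hcl0, smul_zero]
  have hsq : (∑ μ, (c μ : ℂ) • Γ μ - (r : ℂ) • Γ0) ^ 2 =
      (((2 * (1 - lam) + (2 * lam - 1) * s) ^ 2 + r ^ 2 : ℝ) : ℂ) •
        (1 : Matrix (Fin n) (Fin n) ℂ) := by
    have hV := clifford_sum_mul_self Γ hcl (fun μ => (c μ : ℂ))
    rw [hcsum] at hV
    generalize ∑ μ, (c μ : ℂ) • Γ μ = V at hanti hV
    calc (V - (r : ℂ) • Γ0) ^ 2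
        = V * V - (r : ℂ) • (Γ0 * V + V * Γ0) + ((r : ℂ) * r) • (Γ0 * Γ0) := by
          rw [sq, sub_mul, mul_sub, mul_sub, smul_mul_smul_comm, mul_smul_comm, smul_mul_assoc,
            smul_add]
          abel
      _ = _ := by
          rw [hanti, hV, hcl00, smul_zero, sub_zero, ← add_smul]
          push_cast
          ring_nf
  rw [hH, hsq, ← sub_smul, ← Complex.ofReal_sub]
  refine Matrix.PosSemidef.one.smul (Complex.zero_le_real.2 ?_)
  have hcross : 0 ≤ (1 - lam) * (2 * lam - 1) * s :=
    mul_nonneg (mul_nonneg (by linarith) (by linarith)) hk.le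
  nlinarith [mul_nonneg (sq_nonneg (2 * lam - 1)) (sub_nonneg.2 hgap), sq_nonneg (4 * lam - 3)]

end
end
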